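/- Let k be a tensor Markov kernel on (0,1)^d satisfying Assumption SL. Then there exist a constant c > 0 and a level τ_0 such that for every τ ≥ τ_0, when the design points form the full lattice ∏_{j=1}^d { i·2^{−τ} : 1 ≤ i ≤ 2^τ − 1 } of size n = (2^τ − 1)^d, one has sup_{x ∈ (0,1)^d} [ k(x,x) − k(x)^⊤ K^{-1} k(x) ] ≥ c · n^{−1/d}. (The left-hand side equals the worst-case mean squared error of the noiseless kriging predictor with kernel k and the lattice design, when the response surface is a sample path of the zero-mean Gaussian process with kernel k.) -/

import Mathlib

open Matrix

noncomputable section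

/-- The dyadic point `c_{l,i} = i · 2^{-l}`. -/
def cpt (l i : ℕ) : ℝ := (i : ℝ) / 2 ^ l

/-- The multidimensional dyadic point `c_{l,i}`. -/
def cpoint {d : ℕ} (l i : Fin d → ℕ) : Fin d → ℝ := fun j => cpt (l j) (i j)

/-- The set `ρ(l)` of odd multi-indices associated with the level multi-index `l`. -/
def rho {d : ℕ} (l : Fin d → ℕ) : Set (Fin d → ℕ) :=
  {i | ∀ j, Odd (i j) ∧ 1 ≤ i j ∧ i j ≤ 2 ^ (l j) - 1}

/-- The classical sparse grid of level `τ` in dimension `d`. -/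
def SGset (d τ : ℕ) : Set (Fin d → ℝ) :=
  {x | ∃ l : Fin d → ℕ, (∀ j, 1 ≤ l j) ∧ (∑ j, l j) ≤ τ + d - 1 ∧
    ∀ j, ∃ i : ℕ, 1 ≤ i ∧ i ≤ 2 ^ (l j) - 1 ∧ x j = cpt (l j) i}

/-- A tensor Markov kernel on `(0,1)^d` satisfying Assumption SL: factors
`p_j, q_j` are continuous on `[0,1]`, positive on `(0,1)`, satisfy the strict
"determinant" positivity (the precise form of `p_j/q_j` strictly increasing with
`p_j, q_j > 0`), are continuously differentiable on `(0,1)`, and both solve the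
Sturm–Liouville equation `(u_j f')' + v_j f = 0` on `(0,1)`. -/
structure TMKernelSL (d : ℕ) where
  p : Fin d → ℝ → ℝ
  q : Fin d → ℝ → ℝ
  cont_p : ∀ j, ContinuousOn (p j) (Set.Icc 0 1)
  cont_q : ∀ j, ContinuousOn (q j) (Set.Icc 0 1)
  pos_p : ∀ j, ∀ x ∈ Set.Ioo (0:ℝ) 1, 0 < p j x
  pos_q : ∀ j, ∀ x ∈ Set.Ioo (0:ℝ) 1, 0 < q j x
  det_pos : ∀ j, ∀ y ∈ Set.Icc (0:ℝ) 1, ∀ x ∈ Set.Icc (0:ℝ) 1, y < x →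
    0 < p j x * q j y - p j y * q j x
  u : Fin d → ℝ → ℝ
  v : Fin d → ℝ → ℝ
  contDiff_p : ∀ j, ContDiffOn ℝ 1 (p j) (Set.Ioo 0 1)
  contDiff_q : ∀ j, ContDiffOn ℝ 1 (q j) (Set.Ioo 0 1)
  contDiff_u : ∀ j, ContDiffOn ℝ 1 (u j) (Set.Ioo 0 1)
  cont_v : ∀ j, ContinuousOn (v j) (Set.Ioo 0 1)
  sl_p : ∀ j, ∀ x ∈ Set.Ioo (0:ℝ) 1,
    deriv (fun t => u j t * deriv (p j) t) x + v j x * p j x = 0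
  sl_q : ∀ j, ∀ x ∈ Set.Ioo (0:ℝ) 1,
    deriv (fun t => u j t * deriv (q j) t) x + v j x * q j x = 0

/-- The tensor Markov kernel `k(x,x') = ∏_j p_j(min) q_j(max)`. -/
def TMKernelSL.k {d : ℕ} (κ : TMKernelSL d) (x x' : Fin d → ℝ) : ℝ :=
  ∏ j, κ.p j (min (x j) (x' j)) * κ.q j (max (x j) (x' j))

/-- The `j`-th one-dimensional factor kernel of a TM kernel. -/
def TMKernelSL.k1 {d : ℕ} (κ : TMKernelSL d) (j : Fin d) (a b : ℝ) : ℝ :=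
  κ.p j (min a b) * κ.q j (max a b)

/-- Kernel matrix of the design `x_1,…,x_n`. -/
def kerMat {d n : ℕ} (κ : TMKernelSL d) (x : Fin n → Fin d → ℝ) :
    Matrix (Fin n) (Fin n) ℝ :=
  Matrix.of fun a b => κ.k (x a) (x b)

/-- Kernel vector `k(z) = (k(z,x_1),…,k(z,x_n))`. -/
def kerVec {d n : ℕ} (κ : TMKernelSL d) (x : Fin n → Fin d → ℝ) (z : Fin d → ℝ) :
    Fin n → ℝ :=
  fun a => κ.k z (x a)

/-- `x_1,…,x_n` is a truncated sparse grid design: the points are distinct, and for the level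
`τ` with `|X_τ^SG| ≤ n < |X_{τ+1}^SG|`, the design contains all of `X_τ^SG` and is contained
in `X_{τ+1}^SG`. -/
def IsTSGDesign {d n : ℕ} (x : Fin n → Fin d → ℝ) : Prop :=
  Function.Injective x ∧
  ∃ τ : ℕ, 1 ≤ τ ∧ (SGset d τ).ncard ≤ n ∧ n < (SGset d (τ + 1)).ncard ∧
    SGset d τ ⊆ Set.range x ∧ Set.range x ⊆ SGset d (τ + 1)

/-- One-dimensional quantity `η_{l,i}` (the squared RKHS norm of the hat function). -/
def eta1 (p q : ℝ → ℝ) (l i : ℕ) : ℝ :=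
  (p (cpt l (i + 1)) * q (cpt l (i - 1)) - p (cpt l (i - 1)) * q (cpt l (i + 1))) /
    ((p (cpt l i) * q (cpt l (i - 1)) - p (cpt l (i - 1)) * q (cpt l i)) *
      (p (cpt l (i + 1)) * q (cpt l i) - p (cpt l i) * q (cpt l (i + 1))))

/-- Multidimensional `η_{l,i} = ∏_j η^{(j)}_{l_j,i_j}`. -/
def etaP {d : ℕ} (p q : Fin d → ℝ → ℝ) (l i : Fin d → ℕ) : ℝ :=
  ∏ j, eta1 (p j) (q j) (l j) (i j)

/-- One-dimensional hat function `φ_{l,i}` associated with `p, q`. -/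
def phi1 (p q : ℝ → ℝ) (l i : ℕ) (x : ℝ) : ℝ :=
  if cpt l (i - 1) < x ∧ x ≤ cpt l i then
    (p x * q (cpt l (i - 1)) - p (cpt l (i - 1)) * q x) /
      (p (cpt l i) * q (cpt l (i - 1)) - p (cpt l (i - 1)) * q (cpt l i))
  else if cpt l i < x ∧ x < cpt l (i + 1) then
    (p (cpt l (i + 1)) * q x - p x * q (cpt l (i + 1))) /
      (p (cpt l (i + 1)) * q (cpt l i) - p (cpt l i) * q (cpt l (i + 1)))
  else 0

/-- Multidimensional hat function `φ_{l,i}(x) = ∏_j φ^{(j)}_{l_j,i_j}(x_j)`. -/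
def phiD {d : ℕ} (p q : Fin d → ℝ → ℝ) (l i : Fin d → ℕ) (x : Fin d → ℝ) : ℝ :=
  ∏ j, phi1 (p j) (q j) (l j) (i j) (x j)

/-- The open hyperrectangle `R_{l,i} = ∏_j (c_{l_j,i_j−1}, c_{l_j,i_j+1})`. -/
def hyperRect {d : ℕ} (l i : Fin d → ℕ) : Set (Fin d → ℝ) :=
  {z | ∀ j, cpt (l j) (i j - 1) < z j ∧ z j < cpt (l j) (i j + 1)}

/-- Number of nonzero entries of a real matrix. -/
def nnzM {α β : Type*} [Fintype α] [Fintype β] (M : Matrix α β ℝ) : ℕ :=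
  Set.ncard {ab : α × β | M ab.1 ab.2 ≠ 0}

end

/-- Two `C¹` functions with strictly positive determinants `p x * q y - p y * q x` have, near some
point of `(0,1)`, determinants comparable to `x - y`. -/
lemma exists_local_det_bounds {p q : ℝ → ℝ}
    (hq : ∀ x ∈ Set.Ioo (0:ℝ) 1, 0 < q x)
    (hdet : ∀ y ∈ Set.Icc (0:ℝ) 1, ∀ x ∈ Set.Icc (0:ℝ) 1, y < x → 0 < p x * q y - p y * q x)
    (hp' : ContDiffOn ℝ 1 p (Set.Ioo 0 1)) (hq' : ContDiffOn ℝ 1 q (Set.Ioo 0 1)) :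
    ∃ t ∈ Set.Ioo (0:ℝ) 1, ∃ δ > 0, ∃ m > 0, ∃ M > 0, ∀ x y : ℝ, |x - t| < δ → |y - t| < δ →
      y < x → m * (x - y) ≤ p x * q y - p y * q x ∧ p x * q y - p y * q x ≤ M * (x - y) := by
  have hr : ContDiffOn ℝ 1 (fun x => p x / q x) (Set.Ioo 0 1) :=
    hp'.div hq' fun x hx => (hq x hx).ne'
  have hsub : Set.Icc (1/4 : ℝ) (3/4) ⊆ Set.Ioo 0 1 := fun x hx =>
    ⟨by linarith [hx.1], by linarith [hx.2]⟩
  obtain ⟨t, ht, hslope⟩ := exists_deriv_eq_slope (fun x => p x / q x)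
    (by norm_num : (1/4 : ℝ) < 3/4) (hr.continuousOn.mono hsub)
    ((hr.differentiableOn one_ne_zero).mono (Set.Ioo_subset_Icc_self.trans hsub))
  have ht01 : t ∈ Set.Ioo (0:ℝ) 1 := hsub (Set.Ioo_subset_Icc_self ht)
  set D := deriv (fun x => p x / q x) t with hD
  have hDpos : 0 < D := by
    rw [hslope]
    refine div_pos ?_ (by norm_num)
    have h1 := hq (1/4) (by norm_num)
    have h3 := hq (3/4) (by norm_num)
    have := hdet (1/4) (by norm_num) (3/4) (by norm_num) (by norm_num)
    rw [sub_pos, div_lt_div_iff₀ h1 h3]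
    linarith
  have hstrict : HasStrictDerivAt (fun x => p x / q x) D t :=
    (hr.contDiffAt (Ioo_mem_nhds ht01.1 ht01.2)).hasStrictDerivAt one_ne_zero
  have hlin := (hasStrictDerivAt_iff_hasStrictFDerivAt.1 hstrict).isLittleO.bound
    (half_pos hDpos)
  have hqt := hq t ht01
  have hqc : ContinuousAt q t := hq'.continuousOn.continuousAt (Ioo_mem_nhds ht01.1 ht01.2)
  have hqn : ∀ᶠ x in nhds t, q t / 2 < q x ∧ q x < 2 * q t :=
    (hqc.eventually (lt_mem_nhds (by linarith))).and (hqc.eventually (gt_mem_nhds (by linarith)))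
  rw [nhds_prod_eq] at hlin
  obtain ⟨δ₁, hδ₁, hlin⟩ := Metric.nhds_basis_ball.prod_self.eventually_iff.1 hlin
  obtain ⟨δ₂, hδ₂, hqn⟩ := Metric.eventually_nhds_iff.1 hqn
  obtain ⟨δ₃, hδ₃, hmem⟩ := Metric.eventually_nhds_iff.1 (Ioo_mem_nhds ht01.1 ht01.2)
  refine ⟨t, ht01, min δ₁ (min δ₂ δ₃), lt_min hδ₁ (lt_min hδ₂ hδ₃),
    (q t / 2) * (q t / 2) * (D / 2), by positivity, (2 * q t) * (2 * q t) * (3 * D / 2),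
    by positivity, fun x y hx hy hyx => ?_⟩
  simp only [lt_min_iff] at hx hy
  obtain ⟨hx1, hx2⟩ := hqn hx.2.1
  obtain ⟨hy1, hy2⟩ := hqn hy.2.1
  have hqx := hq x (hmem hx.2.2)
  have hqy := hq y (hmem hy.2.2)
  have hxy : 0 < x - y := sub_pos.2 hyx
  have h := @hlin (x, y) ⟨hx.1, hy.1⟩
  simp only [ContinuousLinearMap.toSpanSingleton_apply, smul_eq_mul, Real.norm_eq_abs,
    abs_of_pos hxy] at h
  obtain ⟨hlo, hhi⟩ := abs_le.1 h
  have hfac : p x * q y - p y * q x = q x * q y * (p x / q x - p y / q y) := by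
    field_simp
  rw [hfac, mul_assoc _ (D / 2), mul_assoc _ (3 * D / 2)]
  have hDxy : 0 < D / 2 * (x - y) := by positivity
  have hlo' : D / 2 * (x - y) ≤ p x / q x - p y / q y := by linarith
  have hhi' : p x / q x - p y / q y ≤ 3 * D / 2 * (x - y) := by linarith
  have hr0 : 0 ≤ p x / q x - p y / q y := hDxy.le.trans hlo'
  constructor <;> gcongr

lemma TMKernelSL.k_symm {d : ℕ} (κ : TMKernelSL d) (x y : Fin d → ℝ) : κ.k x y = κ.k y x := by
  simp only [TMKernelSL.k, min_comm, max_comm]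

lemma TMKernelSL.k_pos {d : ℕ} (κ : TMKernelSL d) {x y : Fin d → ℝ}
    (hx : ∀ j, x j ∈ Set.Ioo (0:ℝ) 1) (hy : ∀ j, y j ∈ Set.Ioo (0:ℝ) 1) : 0 < κ.k x y :=
  Finset.prod_pos fun j _ => mul_pos
    (κ.pos_p j _ ⟨lt_min (hx j).1 (hy j).1, min_lt_of_left_lt (hx j).2⟩)
    (κ.pos_q j _ ⟨lt_max_of_lt_left (hx j).1, max_lt (hx j).2 (hy j).2⟩)

lemma TMKernelSL.k_update {d : ℕ} (κ : TMKernelSL d) (c y : Fin d → ℝ) (i : Fin d) (s : ℝ) :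
    κ.k (Function.update c i s) y =
      κ.k1 i s (y i) * ∏ j ∈ Finset.univ.erase i, κ.k1 j (c j) (y j) := by
  rw [TMKernelSL.k, ← Finset.mul_prod_erase _ _ (Finset.mem_univ i)]
  simp only [Function.update_self, TMKernelSL.k1]
  congr 1
  refine Finset.prod_congr rfl fun j hj => ?_
  rw [Function.update_of_ne (Finset.ne_of_mem_erase hj)]

/-- The kriging error for a fixed design is bounded above over `(0,1)^d`. -/
lemma bddAbove_kriging_error {d n : ℕ} (κ : TMKernelSL d) (x : Fin n → Fin d → ℝ)
    (hx : ∀ a j, x a j ∈ Set.Ioo (0:ℝ) 1) :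
    BddAbove {e : ℝ | ∃ z : Fin d → ℝ, (∀ j, z j ∈ Set.Ioo (0:ℝ) 1) ∧
      e = κ.k z z - kerVec κ x z ⬝ᵥ ((kerMat κ x)⁻¹ *ᵥ kerVec κ x z)} := by
  have hk : ∀ g : (Fin d → ℝ) → Fin d → ℝ, Continuous g →
      (∀ z ∈ Set.Icc (0 : Fin d → ℝ) 1, g z ∈ Set.Icc (0 : Fin d → ℝ) 1) →
      ContinuousOn (fun z => κ.k z (g z)) (Set.Icc (0 : Fin d → ℝ) 1) := by
    intro g hg hmem
    unfold TMKernelSL.k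
    refine continuousOn_finsetProd _ fun j _ => ContinuousOn.mul ?_ ?_
    · refine (κ.cont_p j).comp (by fun_prop) fun z hz => ?_
      exact ⟨le_min (hz.1 j) ((hmem z hz).1 j), min_le_of_left_le (hz.2 j)⟩
    · refine (κ.cont_q j).comp (by fun_prop) fun z hz => ?_
      exact ⟨le_max_of_le_left (hz.1 j), max_le (hz.2 j) ((hmem z hz).2 j)⟩
  have hvec : ∀ a, ContinuousOn (fun z => kerVec κ x z a) (Set.Icc (0 : Fin d → ℝ) 1) := fun a =>
    hk (fun _ => x a) continuous_const
      fun _ _ => ⟨fun j => (hx a j).1.le, fun j => (hx a j).2.le⟩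
  have hcont : ContinuousOn
      (fun z => κ.k z z - kerVec κ x z ⬝ᵥ ((kerMat κ x)⁻¹ *ᵥ kerVec κ x z))
      (Set.Icc (0 : Fin d → ℝ) 1) := by
    refine (hk id continuous_id fun _ h => h).sub ?_
    simp only [dotProduct, mulVec]
    exact continuousOn_finsetSum _ fun a _ => (hvec a).mul <|
      continuousOn_finsetSum _ fun b _ => continuousOn_const.mul (hvec b)
  refine (isCompact_Icc.bddAbove_image hcont).mono ?_
  rintro e ⟨z, hz, rfl⟩
  exact ⟨z, ⟨fun j => (hz j).1.le, fun j => (hz j).2.le⟩, rfl⟩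

/-- If `c` with `i`-th coordinate replaced by `a` or `b` is a design point, and no design point has
its `i`-th coordinate in `(a, b)`, then the kriging error at `c` with `i`-th coordinate `s ∈ (a, b)`
is at least the variance of the corresponding one-dimensional bridge times the variance in the
remaining coordinates. -/
lemma le_kriging_error_update {d n : ℕ} (κ : TMKernelSL d) (x : Fin n → Fin d → ℝ) (i : Fin d)
    (c : Fin d → ℝ) {a b s : ℝ} {ia ib : Fin n} (hia : x ia = Function.update c i a)
    (hib : x ib = Function.update c i b) (hx : ∀ k j, x k j ∈ Set.Ioo (0:ℝ) 1)
    (hz : ∀ j, Function.update c i s j ∈ Set.Ioo (0:ℝ) 1) (has : a < s) (hsb : s < b)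
    (hgap : ∀ k, x k i ≤ a ∨ b ≤ x k i) :
    (κ.p i s * κ.q i a - κ.p i a * κ.q i s) * (κ.p i b * κ.q i s - κ.p i s * κ.q i b) /
        (κ.p i b * κ.q i a - κ.p i a * κ.q i b) *
        ∏ j ∈ Finset.univ.erase i, κ.k1 j (c j) (c j) ≤
      κ.k (Function.update c i s) (Function.update c i s) -
        kerVec κ x (Function.update c i s) ⬝ᵥ
          ((kerMat κ x)⁻¹ *ᵥ kerVec κ x (Function.update c i s)) := by
  have ha : a ∈ Set.Icc (0:ℝ) 1 := by
    have := hx ia i; rw [hia, Function.update_self] at this; exact Set.Ioo_subset_Icc_self this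
  have hb : b ∈ Set.Icc (0:ℝ) 1 := by
    have := hx ib i; rw [hib, Function.update_self] at this; exact Set.Ioo_subset_Icc_self this
  have hs : s ∈ Set.Icc (0:ℝ) 1 := by
    have := hz i; rw [Function.update_self] at this; exact Set.Ioo_subset_Icc_self this
  have hsa := κ.det_pos i a ha s hs has
  have hbs := κ.det_pos i s hs b hb hsb
  have hba := κ.det_pos i a ha b hb (has.trans hsb)
  set z := Function.update c i s with hzdef
  set α := (κ.p i b * κ.q i s - κ.p i s * κ.q i b) / (κ.p i b * κ.q i a - κ.p i a * κ.q i b)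
    with hα
  set β := (κ.p i s * κ.q i a - κ.p i a * κ.q i s) / (κ.p i b * κ.q i a - κ.p i a * κ.q i b)
    with hβ
  have hα0 : 0 < α := div_pos hbs hba
  have hβ0 : 0 < β := div_pos hsa hba
  have hps : κ.p i s = α * κ.p i a + β * κ.p i b := by
    rw [hα, hβ, div_mul_eq_mul_div, div_mul_eq_mul_div, ← add_div, eq_div_iff hba.ne']; ring
  have hqs : κ.q i s = α * κ.q i a + β * κ.q i b := by
    rw [hα, hβ, div_mul_eq_mul_div, div_mul_eq_mul_div, ← add_div, eq_div_iff hba.ne']; ring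
  have hinterp : ∀ k, κ.k z (x k) = α * κ.k (x ia) (x k) + β * κ.k (x ib) (x k) := by
    intro k
    rw [hia, hib, hzdef, κ.k_update, κ.k_update, κ.k_update]
    have : κ.k1 i s (x k i) = α * κ.k1 i a (x k i) + β * κ.k1 i b (x k i) := by
      unfold TMKernelSL.k1
      rcases hgap k with h | h
      · rw [min_eq_right (h.trans has.le), max_eq_left (h.trans has.le), min_eq_right h,
          max_eq_left h, min_eq_right (h.trans (has.trans hsb).le),
          max_eq_left (h.trans (has.trans hsb).le), hqs]
        ring
      · rw [min_eq_left (hsb.le.trans h), max_eq_right (hsb.le.trans h), min_eq_left h,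
          max_eq_right h, min_eq_left ((has.trans hsb).le.trans h),
          max_eq_right ((has.trans hsb).le.trans h), hps]
        ring
    rw [this]; ring
  set w : Fin n → ℝ := α • Pi.single ia 1 + β • Pi.single ib 1 with hw
  have hKw : kerMat κ x *ᵥ w = kerVec κ x z := by
    ext k
    rw [hw, mulVec_add, mulVec_smul, mulVec_smul, mulVec_single_one, mulVec_single_one]
    simp only [Pi.add_apply, Pi.smul_apply, smul_eq_mul, kerVec, hinterp, col_apply, kerMat,
      of_apply, κ.k_symm (x k)]
  have hdot : kerVec κ x z ⬝ᵥ w = α * κ.k z (x ia) + β * κ.k z (x ib) := by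
    rw [hw, dotProduct_add, dotProduct_smul, dotProduct_smul, dotProduct_single_one,
      dotProduct_single_one]
    rfl
  have hle : kerVec κ x z ⬝ᵥ ((kerMat κ x)⁻¹ *ᵥ kerVec κ x z) ≤
      α * κ.k z (x ia) + β * κ.k z (x ib) := by
    by_cases hdet : IsUnit (kerMat κ x).det
    · rw [← hdot, ← hKw, mulVec_mulVec, nonsing_inv_mul _ hdet, one_mulVec]
    · rw [nonsing_inv_apply_not_isUnit _ hdet, zero_mulVec, dotProduct_zero]
      have := κ.k_pos hz (hx ia)
      have := κ.k_pos hz (hx ib)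
      positivity
  refine le_trans (le_of_eq ?_) (sub_le_sub_left hle _)
  have hprod : ∀ t : ℝ, κ.k z (Function.update c i t) =
      κ.k1 i s t * ∏ j ∈ Finset.univ.erase i, κ.k1 j (c j) (c j) := by
    intro t
    rw [hzdef, κ.k_update, Function.update_self]
    congr 1
    refine Finset.prod_congr rfl fun j hj => ?_
    rw [Function.update_of_ne (Finset.ne_of_mem_erase hj)]
  have hself : κ.k z z = κ.k z (Function.update c i s) := rfl
  rw [hself, hia, hib, hprod, hprod, hprod]
  unfold TMKernelSL.k1
  rw [min_self, max_self, min_eq_right has.le, max_eq_left has.le, min_eq_left hsb.le,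
    max_eq_right hsb.le]
  have hkey : (κ.p i s * κ.q i a - κ.p i a * κ.q i s) *
      (κ.p i b * κ.q i s - κ.p i s * κ.q i b) / (κ.p i b * κ.q i a - κ.p i a * κ.q i b) =
      β * (κ.p i b * κ.q i s - κ.p i s * κ.q i b) := by
    rw [hβ]; ring
  rw [hkey]
  linear_combination (-κ.q i s * ∏ j ∈ Finset.univ.erase i, (κ.p j (min (c j) (c j)) *
    κ.q j (max (c j) (c j)))) * hps

/-- **Proposition 2, Ding & Zhang.** Noiseless kriging with a TM kernel satisfying Assumption SL
and the full lattice design of level `τ` (of size `n = (2^τ − 1)^d`): the worst-case MSE over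
`(0,1)^d` is at least `c · n^{−1/d}` for all sufficiently large levels. -/
theorem kriging_TM_lattice_lower_bound (d : ℕ) (hd : 1 ≤ d) (κ : TMKernelSL d) :
    ∃ c : ℝ, 0 < c ∧ ∃ τ₀ : ℕ, ∀ τ : ℕ, τ₀ ≤ τ → ∀ n : ℕ, n = (2 ^ τ - 1) ^ d →
      ∀ x : Fin n → Fin d → ℝ, Function.Injective x →
        Set.range x = {y : Fin d → ℝ | ∀ j, ∃ i : ℕ, 1 ≤ i ∧ i ≤ 2 ^ τ - 1 ∧ y j = cpt τ i} →
        c * (n : ℝ) ^ (-(1 : ℝ) / d) ≤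
          sSup {e : ℝ | ∃ z : Fin d → ℝ, (∀ j, z j ∈ Set.Ioo (0:ℝ) 1) ∧
            e = κ.k z z - kerVec κ x z ⬝ᵥ ((kerMat κ x)⁻¹ *ᵥ kerVec κ x z)} := by
  classical
  set i : Fin d := ⟨0, hd⟩
  obtain ⟨t, ht, δ, hδ, m, hm, M, hM, hbd⟩ := exists_local_det_bounds (κ.pos_q i) (κ.det_pos i)
    (κ.contDiff_p i) (κ.contDiff_q i)
  set P := ∏ j ∈ Finset.univ.erase i, κ.k1 j (1/2) (1/2) with hPdef
  have hP : 0 < P := Finset.prod_pos fun j _ => by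
    simp only [TMKernelSL.k1, min_self, max_self]
    exact mul_pos (κ.pos_p j _ (by norm_num)) (κ.pos_q j _ (by norm_num))
  obtain ⟨τ₁, hτ₁⟩ := exists_pow_lt_of_lt_one (lt_min hδ (lt_min ht.1 (sub_pos.2 ht.2)))
    (by norm_num : (1/2 : ℝ) < 1)
  refine ⟨m ^ 2 / (8 * M) * P, by positivity, max τ₁ 1, fun τ hτ n hn x _ hrange => ?_⟩
  have hτ1 : 1 ≤ τ := (le_max_right _ _).trans hτ
  set h : ℝ := 1 / 2 ^ τ with hh
  have hh0 : 0 < h := by positivity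
  have hhlt : h < min δ (min t (1 - t)) := by
    refine lt_of_le_of_lt ?_ hτ₁
    rw [hh, ← _root_.one_div_pow]
    exact pow_le_pow_of_le_one (by norm_num) (by norm_num) ((le_max_left _ _).trans hτ)
  obtain ⟨hhδ, hht, hht'⟩ : h < δ ∧ h < t ∧ h < 1 - t := by
    simpa only [lt_min_iff] using hhlt
  have hcpt : ∀ k : ℕ, cpt τ k = k * h := fun k => by rw [cpt, hh]; ring
  have h2h : (2 : ℝ) ^ τ * h = 1 := by rw [hh]; field_simp
  set l := ⌊t / h⌋₊ with hl
  have hl1 : (l : ℝ) * h ≤ t := (le_div_iff₀ hh0).1 (Nat.floor_le (div_pos ht.1 hh0).le)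
  have hl2 : t < ((l : ℝ) + 1) * h := (div_lt_iff₀ hh0).1 (Nat.lt_floor_add_one _)
  have hlpos : 1 ≤ l := (Nat.one_le_floor_iff _).2 ((one_le_div hh0).2 hht.le)
  have hllt : l + 1 < 2 ^ τ := by
    have : ((l : ℝ) + 1) * h < 2 ^ τ * h := by rw [h2h]; linarith
    exact_mod_cast lt_of_mul_lt_mul_right this hh0.le
  set c : Fin d → ℝ := fun _ => 1/2 with hc
  have hhalf : (1/2 : ℝ) = cpt τ (2 ^ (τ - 1)) := by
    obtain ⟨k, rfl⟩ : ∃ k, τ = k + 1 := ⟨τ - 1, by omega⟩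
    simp only [cpt, Nat.add_sub_cancel]
    push_cast
    field_simp
    ring
  have hhalf' : 2 ^ (τ - 1) ≤ 2 ^ τ - 1 :=
    Nat.le_sub_one_of_lt (Nat.pow_lt_pow_right one_lt_two (by omega))
  have hmem : ∀ k : ℕ, 1 ≤ k → k ≤ 2 ^ τ - 1 → Function.update c i (cpt τ k) ∈ Set.range x := by
    intro k hk1 hk2
    rw [hrange]
    intro j
    by_cases hj : j = i
    · subst hj
      exact ⟨k, hk1, hk2, Function.update_self ..⟩
    · exact ⟨_, Nat.one_le_two_pow, hhalf', by rw [Function.update_of_ne hj, hc, hhalf]⟩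
  obtain ⟨ia, hia⟩ := hmem l hlpos (by omega)
  obtain ⟨ib, hib⟩ := hmem (l + 1) (by omega) (by omega)
  have hlat : ∀ k j, ∃ r : ℕ, 1 ≤ r ∧ r ≤ 2 ^ τ - 1 ∧ x k j = cpt τ r := fun k => by
    have := Set.mem_range_self (f := x) k
    rwa [hrange] at this
  have hx : ∀ k j, x k j ∈ Set.Ioo (0:ℝ) 1 := by
    intro k j
    obtain ⟨r, hr1, hr2, hr⟩ := hlat k j
    rw [hr, hcpt]
    have hr3 : (r : ℝ) < 2 ^ τ := by exact_mod_cast (by omega : r < 2 ^ τ)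
    have hr4 : (0 : ℝ) < r := by exact_mod_cast hr1
    exact ⟨by positivity, by rw [← h2h]; gcongr⟩
  have hgap : ∀ k, x k i ≤ cpt τ l ∨ cpt τ (l + 1) ≤ x k i := by
    intro k
    obtain ⟨r, -, -, hr⟩ := hlat k i
    rw [hr, hcpt, hcpt, hcpt]
    rcases Nat.lt_or_ge l r with h' | h'
    · right
      gcongr
      exact h'
    · left
      gcongr
  have ha : cpt τ l = l * h := hcpt l
  have hb : cpt τ (l + 1) = l * h + h := by rw [hcpt]; push_cast; ring
  rw [hb] at hib hgap
  rw [ha] at hia hgap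
  set a := (l : ℝ) * h with hadef
  have hl2' : t < a + h := by linarith
  have hz : ∀ j, Function.update c i (a + h / 2) j ∈ Set.Ioo (0:ℝ) 1 := by
    intro j
    by_cases hj : j = i
    · subst hj
      rw [Function.update_self]
      constructor <;> linarith
    · rw [Function.update_of_ne hj]
      norm_num [hc]
  have hbound := le_kriging_error_update κ x i c hia hib hx hz (by linarith) (by linarith) hgap
  have hsup := le_csSup (bddAbove_kriging_error κ x hx) ⟨_, hz, rfl⟩
  refine le_trans (le_trans ?_ hbound) hsup
  have d1 := (hbd (a + h / 2) a (abs_lt.2 ⟨by linarith, by linarith⟩)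
    (abs_lt.2 ⟨by linarith, by linarith⟩) (by linarith)).1
  have d2 := (hbd (a + h) (a + h / 2) (abs_lt.2 ⟨by linarith, by linarith⟩)
    (abs_lt.2 ⟨by linarith, by linarith⟩) (by linarith)).1
  obtain ⟨d3, d4⟩ := hbd (a + h) a (abs_lt.2 ⟨by linarith, by linarith⟩)
    (abs_lt.2 ⟨by linarith, by linarith⟩) (by linarith)
  have hn' : (n : ℝ) ^ (-(1 : ℝ) / d) ≤ 2 * h := by
    have h2 : (2 : ℝ) ≤ 2 ^ τ := by simpa using pow_le_pow_right₀ one_le_two hτ1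
    have hN : (n : ℝ) = (2 ^ τ - 1 : ℝ) ^ d := by
      rw [hn, Nat.cast_pow, Nat.cast_sub Nat.one_le_two_pow]
      push_cast
      rfl
    have h0 : (0 : ℝ) ≤ 2 ^ τ - 1 := by linarith
    rw [hN, neg_div, Real.rpow_neg (pow_nonneg h0 _), one_div,
      Real.pow_rpow_inv_natCast h0 (by omega), inv_le_iff_one_le_mul₀ (by linarith)]
    nlinarith
  have hdiv : m ^ 2 / (4 * M) * h ≤
      (κ.p i (a + h / 2) * κ.q i a - κ.p i a * κ.q i (a + h / 2)) *
        (κ.p i (a + h) * κ.q i (a + h / 2) - κ.p i (a + h / 2) * κ.q i (a + h)) /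
        (κ.p i (a + h) * κ.q i a - κ.p i a * κ.q i (a + h)) := by
    have e1 : a + h / 2 - a = h / 2 := by ring
    have e2 : a + h - (a + h / 2) = h / 2 := by ring
    have e3 : a + h - a = h := by ring
    rw [e1] at d1
    rw [e2] at d2
    rw [e3] at d3 d4
    calc m ^ 2 / (4 * M) * h = (m * (h / 2)) * (m * (h / 2)) / (M * h) := by field_simp; ring
      _ ≤ _ := by
        have hmh : 0 < m * h := by positivity
        have hmh2 : 0 < m * (h / 2) := by positivity
        exact div_le_div₀ (mul_nonneg (hmh2.le.trans d1) (hmh2.le.trans d2))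
          (mul_le_mul d1 d2 hmh2.le (hmh2.le.trans d1)) (hmh.trans_le d3) d4
  calc m ^ 2 / (8 * M) * P * (n : ℝ) ^ (-(1 : ℝ) / d)
      ≤ m ^ 2 / (8 * M) * P * (2 * h) := by gcongr
    _ = m ^ 2 / (4 * M) * h * P := by field_simp; ring
    _ ≤ _ := mul_le_mul_of_nonneg_right hdiv hP.le
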